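/- arXiv:1212.1152 — 3 statements merged into one kernel-verified Lean document; each statement's English description precedes it below -/
import Mathlib

section
/- Let ζ and η be real random variables on a probability space (Ω, P) such that the joint distribution of the pair (ζ, η) is a centered (mean zero) Gaussian measure on ℝ². Then E[(ζ² − η²)²] ≤ 3 · E[(ζ − η)²] · E[(ζ + η)²]. -/
open MeasureTheory ProbabilityTheory

namespace ProbabilityTheory

open scoped NNReal

lemma integral_sq_gaussianReal_zero (v : ℝ≥0) : ∫ x, x ^ 2 ∂gaussianReal 0 v = v := by
  have h := variance_fun_id_gaussianReal (μ := 0) (v := v)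
  rw [variance_eq_integral measurable_id'.aemeasurable] at h
  simpa using h

lemma integral_pow_four_gaussianReal_zero (v : ℝ≥0) :
    ∫ x, x ^ 4 ∂gaussianReal 0 v = 3 * (v : ℝ) ^ 2 := by
  have hderiv : ∀ (p p' : ℝ → ℝ), (∀ t, HasDerivAt p (p' t) t) →
      deriv (fun t ↦ p t * Real.exp (v * t ^ 2 / 2)) =
        fun t ↦ (p' t + p t * (v * t)) * Real.exp (v * t ^ 2 / 2) := by
    intro p p' hp
    ext t
    have he : HasDerivAt (fun t : ℝ ↦ Real.exp (v * t ^ 2 / 2))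
        (Real.exp (v * t ^ 2 / 2) * (v * (2 * t) / 2)) t := by
      simpa using ((((hasDerivAt_id t).pow 2).const_mul (v : ℝ)).div_const 2).exp
    rw [((hp t).fun_mul he).deriv]
    ring
  have hmoment : ∫ x, x ^ 4 ∂gaussianReal 0 v =
      iteratedDeriv 4 (mgf (fun x ↦ x) (gaussianReal 0 v)) 0 := by
    rw [iteratedDeriv_mgf_zero] <;> simp
  have hmgf : mgf (fun x ↦ x) (gaussianReal 0 v) =
      fun t ↦ (1 : ℝ) * Real.exp (v * t ^ 2 / 2) := by
    simp [mgf_fun_id_gaussianReal]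
  have hlin (c t : ℝ) : HasDerivAt (fun t ↦ c * t) c t := by
    simpa using (hasDerivAt_id t).const_mul c
  have hpow (c : ℝ) (n : ℕ) (t : ℝ) :
      HasDerivAt (fun t ↦ c * t ^ n) (c * (n * t ^ (n - 1))) t :=
    (hasDerivAt_pow n t).const_mul c
  rw [hmoment, hmgf, iteratedDeriv_succ', iteratedDeriv_succ', iteratedDeriv_succ',
    iteratedDeriv_one, hderiv (fun _ ↦ 1) (fun _ ↦ 0) (fun t ↦ hasDerivAt_const t 1)]
  have h1 : (fun t : ℝ ↦ (0 + 1 * (v * t)) * Real.exp (v * t ^ 2 / 2)) =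
      fun t ↦ (v * t) * Real.exp (v * t ^ 2 / 2) := by simp
  rw [h1, hderiv _ _ (hlin v)]
  have h2 : (fun t : ℝ ↦ (v + v * t * (v * t)) * Real.exp (v * t ^ 2 / 2)) =
      fun t ↦ (v + (v : ℝ) ^ 2 * t ^ 2) * Real.exp (v * t ^ 2 / 2) := by
    ext t; ring
  rw [h2, hderiv _ _ (fun t ↦ (hpow ((v : ℝ) ^ 2) 2 t).const_add (v : ℝ))]
  have h3 : (fun t : ℝ ↦ ((v : ℝ) ^ 2 * ((2 : ℕ) * t ^ (2 - 1)) +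
        (v + (v : ℝ) ^ 2 * t ^ 2) * (v * t)) * Real.exp (v * t ^ 2 / 2)) =
      fun t ↦ (3 * (v : ℝ) ^ 2 * t + (v : ℝ) ^ 3 * t ^ 3) * Real.exp (v * t ^ 2 / 2) := by
    ext t; push_cast; ring
  rw [h3, hderiv _ _ (fun t ↦ (hlin (3 * (v : ℝ) ^ 2) t).fun_add (hpow ((v : ℝ) ^ 3) 3 t))]
  simp

variable {Ω : Type*} [MeasurableSpace Ω] {P : Measure Ω} {X Y : Ω → ℝ} {s t : ℝ≥0}

lemma integral_sq_of_map_eq_gaussianReal_zero (hX : AEMeasurable X P)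
    (h : P.map X = gaussianReal 0 s) : ∫ ω, X ω ^ 2 ∂P = s := by
  rw [← integral_sq_gaussianReal_zero, ← h, integral_map hX (by fun_prop)]

lemma integral_pow_four_of_map_eq_gaussianReal_zero (hX : AEMeasurable X P)
    (h : P.map X = gaussianReal 0 s) : ∫ ω, X ω ^ 4 ∂P = 3 * (s : ℝ) ^ 2 := by
  rw [← integral_pow_four_gaussianReal_zero, ← h, integral_map hX (by fun_prop)]

lemma integrable_pow_of_map_eq_gaussianReal {m : ℝ} (hX : AEMeasurable X P)
    (h : P.map X = gaussianReal m s) (n : ℕ) : Integrable (fun ω ↦ X ω ^ n) P := by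
  have hi : Integrable (fun x : ℝ ↦ x ^ n) (P.map X) := by
    rw [h]
    exact integrable_pow_of_mem_interior_integrableExpSet (X := fun x ↦ x) (by simp) n
  exact hi.comp_aemeasurable hX

lemma ae_eq_zero_of_map_eq_gaussianReal_zero (hX : AEMeasurable X P)
    (h : P.map X = gaussianReal 0 0) : X =ᵐ[P] 0 := by
  have hint := integral_sq_of_map_eq_gaussianReal_zero hX h
  rw [NNReal.coe_zero, integral_eq_zero_iff_of_nonneg (fun _ ↦ sq_nonneg _)
    (integrable_pow_of_map_eq_gaussianReal hX h 2)] at hint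
  filter_upwards [hint] with ω hω
  simpa using hω

/-- For centered real Gaussian random variables `X` and `Y`, not necessarily jointly Gaussian,
`E[X² Y²] ≤ 3 E[X²] E[Y²]`. -/
lemma integral_mul_sq_le_of_map_eq_gaussianReal_zero
    (hX : AEMeasurable X P) (hY : AEMeasurable Y P)
    (hXs : P.map X = gaussianReal 0 s) (hYt : P.map Y = gaussianReal 0 t) :
    ∫ ω, (X ω * Y ω) ^ 2 ∂P ≤ 3 * (∫ ω, X ω ^ 2 ∂P) * (∫ ω, Y ω ^ 2 ∂P) := by
  rw [integral_sq_of_map_eq_gaussianReal_zero hX hXs,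
    integral_sq_of_map_eq_gaussianReal_zero hY hYt]
  rcases eq_or_ne s 0 with rfl | hs
  · have hzero : (fun ω ↦ (X ω * Y ω) ^ 2) =ᵐ[P] 0 := by
      filter_upwards [ae_eq_zero_of_map_eq_gaussianReal_zero hX hXs] with ω hω
      simp [hω]
    simp [integral_congr_ae hzero]
  rcases eq_or_ne t 0 with rfl | ht
  · have hzero : (fun ω ↦ (X ω * Y ω) ^ 2) =ᵐ[P] 0 := by
      filter_upwards [ae_eq_zero_of_map_eq_gaussianReal_zero hY hYt] with ω hω
      simp [hω]
    simp [integral_congr_ae hzero]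
  have hs' : (0 : ℝ) < s := by positivity
  have ht' : (0 : ℝ) < t := by positivity
  have hX4 := (integrable_pow_of_map_eq_gaussianReal hX hXs 4).const_mul ((t : ℝ) / (2 * s))
  have hY4 := (integrable_pow_of_map_eq_gaussianReal hY hYt 4).const_mul ((s : ℝ) / (2 * t))
  calc ∫ ω, (X ω * Y ω) ^ 2 ∂P
      ≤ ∫ ω, ((t : ℝ) / (2 * s) * X ω ^ 4 + (s : ℝ) / (2 * t) * Y ω ^ 4) ∂P := by
        refine integral_mono_of_nonneg (.of_forall fun _ ↦ sq_nonneg _) (hX4.add hY4)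
          (.of_forall fun ω ↦ ?_)
        have key : (t : ℝ) / (2 * s) * X ω ^ 4 + (s : ℝ) / (2 * t) * Y ω ^ 4 - (X ω * Y ω) ^ 2 =
            (t * X ω ^ 2 - s * Y ω ^ 2) ^ 2 / (2 * s * t) := by
          field_simp
          ring
        have hnonneg : 0 ≤ (t * X ω ^ 2 - s * Y ω ^ 2) ^ 2 / (2 * s * t) := by positivity
        exact sub_nonneg.mp (key ▸ hnonneg)
    _ = 3 * s * t := by
        rw [integral_add hX4 hY4, integral_const_mul, integral_const_mul,
          integral_pow_four_of_map_eq_gaussianReal_zero hX hXs,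
          integral_pow_four_of_map_eq_gaussianReal_zero hY hYt]
        field_simp
        ring

end ProbabilityTheory

/-- If the pair `(ζ, η)` has a centered Gaussian joint distribution
(equivalently, every linear combination `a • ζ + b • η` is a centered real Gaussian),
then `E[(ζ² − η²)²] ≤ 3 * E[(ζ − η)²] * E[(ζ + η)²]`. -/
theorem stmt_4
    {Ω : Type*} [MeasurableSpace Ω] (P : Measure Ω) [IsProbabilityMeasure P]
    (ζ η : Ω → ℝ) (hζ : Measurable ζ) (hη : Measurable η)
    (hgauss : ∀ a b : ℝ, ∃ v : NNReal,
      Measure.map (fun ω => a * ζ ω + b * η ω) P = gaussianReal 0 v) :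
    ∫ ω, (ζ ω ^ 2 - η ω ^ 2) ^ 2 ∂P ≤
      3 * (∫ ω, (ζ ω - η ω) ^ 2 ∂P) * (∫ ω, (ζ ω + η ω) ^ 2 ∂P) := by
  obtain ⟨s, hs⟩ := hgauss 1 (-1)
  obtain ⟨t, ht⟩ := hgauss 1 1
  simp only [one_mul, neg_one_mul, ← sub_eq_add_neg] at hs ht
  have h := integral_mul_sq_le_of_map_eq_gaussianReal_zero (by fun_prop) (by fun_prop) hs ht
  convert h using 4
  ring
end

section
/- For each integer n ≥ 1 and λ ∈ ℝ, let A_n(λ) be the 2×2 real matrix A_n(λ) = I + (1/(2n)) · [[−λ, 2 − λ/(2n)], [−λ², λ − λ²/(2n)]], and let F_n(λ) be the first component of the vector A_n(λ)^n · (0, 1)ᵀ. Then the sequence of functions F_n converges, uniformly on every compact subset of ℝ, to the function ω defined by ω(λ) = 2·sin(λ/2)/λ for λ ≠ 0 and ω(0) = 1. -/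
open Matrix Filter

theorem Matrix.pow_eq_chebyshevU_of_det_eq_one {R : Type*} [CommRing R]
    (A : Matrix (Fin 2) (Fin 2) R) {c : R} (hdet : A.det = 1) (htr : A.trace = 2 * c) (n : ℕ) :
    A ^ n = (Polynomial.Chebyshev.U R ((n : ℤ) - 1)).eval c • A
      - (Polynomial.Chebyshev.U R ((n : ℤ) - 2)).eval c • 1 := by
  have hsq : A * A = (2 * c) • A - 1 := by
    rw [Matrix.det_fin_two] at hdet
    rw [Matrix.trace_fin_two] at htr
    rw [← htr, Matrix.eta_fin_two A]
    ext i j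
    fin_cases i <;> fin_cases j <;>
      simp [Matrix.mul_apply, Fin.sum_univ_two] <;>
      first | ring1 | linear_combination -hdet
  induction n with
  | zero => simp
  | succ n ih =>
    have hU := congrArg (Polynomial.eval c) (Polynomial.Chebyshev.U_eq R (n : ℤ))
    simp only [Polynomial.eval_sub, Polynomial.eval_mul, Polynomial.eval_X,
      Polynomial.eval_ofNat] at hU
    rw [pow_succ, ih, sub_mul, smul_mul_assoc, smul_mul_assoc, one_mul, hsq,
      show ((n + 1 : ℕ) : ℤ) - 1 = n by push_cast; ring,
      show ((n + 1 : ℕ) : ℤ) - 2 = n - 1 by push_cast; ring, hU]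
    module

theorem Real.mul_sinc (x : ℝ) : x * Real.sinc x = Real.sin x := by
  rcases eq_or_ne x 0 with rfl | hx
  · simp
  · rw [Real.sinc_of_ne_zero hx, mul_div_cancel₀ _ hx]

theorem Real.sinc_two_mul (x : ℝ) : Real.sinc (2 * x) = Real.sinc x * Real.cos x := by
  rcases eq_or_ne x 0 with rfl | hx
  · simp
  · refine mul_left_cancel₀ (mul_ne_zero two_ne_zero hx) ?_
    rw [Real.mul_sinc, Real.sin_two_mul, ← Real.mul_sinc x]
    ring

theorem Real.chebyshevU_cos_mul_sinc (m : ℤ) (θ : ℝ) :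
    (Polynomial.Chebyshev.U ℝ m).eval (Real.cos θ) * Real.sinc θ
      = (m + 1) * Real.sinc ((m + 1) * θ) := by
  rcases eq_or_ne θ 0 with rfl | hθ
  · simp [Polynomial.Chebyshev.U_eval_one]
  · refine mul_left_cancel₀ hθ ?_
    have h := Polynomial.Chebyshev.U_real_cos θ m
    rw [← Real.mul_sinc θ, ← Real.mul_sinc ((m + 1) * θ)] at h
    linear_combination h

theorem Real.sinc_arcsin_ne_zero (x : ℝ) : Real.sinc (Real.arcsin x) ≠ 0 := by
  rcases eq_or_ne (Real.arcsin x) 0 with h | h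
  · simp [h]
  · rw [Real.sinc_of_ne_zero h]
    refine div_ne_zero (fun hs => h ?_) h
    have h₁ := Real.neg_pi_div_two_le_arcsin x
    have h₂ := Real.arcsin_le_pi_div_two x
    exact (Real.sin_eq_zero_iff_of_lt_of_lt (by linarith [Real.pi_pos])
      (by linarith [Real.pi_pos])).1 hs

/-- The transfer matrix over one period of length `1 / n`, in the variable `x = l / (2 * n)`. -/
theorem transferMatrix_pow_mulVec_apply_zero {n : ℕ} (hn : 1 ≤ n) {l x : ℝ}
    (hx : x = l / (2 * (n : ℝ))) (hx₂ : |x| < 2) :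
    (((1 + (1 / (2 * (n : ℝ))) • !![-l, 2 - x; -l ^ 2, l - l * x] :
        Matrix (Fin 2) (Fin 2) ℝ)) ^ n *ᵥ ![0, 1]) 0
      = (1 - x / 2) * Real.sinc (l / 2 / Real.sinc (Real.arcsin (x / 2)))
        / (Real.sinc (Real.arcsin (x / 2)) * Real.cos (Real.arcsin (x / 2))) := by
  obtain ⟨hx₃, hx₄⟩ := abs_lt.1 hx₂
  have hn₀ : (n : ℝ) ≠ 0 := by positivity
  have hl : l = 2 * n * x := by rw [hx]; field_simp
  set α := Real.arcsin (x / 2) with hα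
  have hsin : Real.sin α = x / 2 := Real.sin_arcsin (by linarith) (by linarith)
  have hsinc : Real.sinc α ≠ 0 := Real.sinc_arcsin_ne_zero _
  have hcos : Real.cos α ≠ 0 := by
    rw [hα, Real.cos_arcsin]
    exact (Real.sqrt_pos.2 (by nlinarith)).ne'
  have harg : l / 2 / Real.sinc α = n * (2 * α) := by
    rw [div_eq_iff hsinc, hl]
    linear_combination (-2 * n : ℝ) * hsin - 2 * n * Real.mul_sinc α
  have hU := Real.chebyshevU_cos_mul_sinc ((n : ℤ) - 1) (2 * α)
  push_cast at hU
  rw [sub_add_cancel, Real.sinc_two_mul] at hU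
  have hcos₂ : Real.cos (2 * α) = 1 - x ^ 2 / 2 := by
    rw [Real.cos_two_mul, Real.cos_sq', hsin]
    ring
  rw [Matrix.pow_eq_chebyshevU_of_det_eq_one _ (c := Real.cos (2 * α))]
  · rw [harg, eq_div_iff (mul_ne_zero hsinc hcos)]
    generalize Real.sinc (n * (2 * α)) = s at hU ⊢
    simp [Matrix.mulVec, dotProduct, Fin.sum_univ_two]
    field_simp
    linear_combination hU
  · rw [Matrix.det_fin_two, hl]
    simp
    field_simp
    ring
  · rw [Matrix.trace_fin_two, hcos₂, hl]
    simp
    field_simp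
    ring

/-- With `A n λ = I + (1/(2n)) · [[−λ, 2 − λ/(2n)], [−λ², λ − λ²/(2n)]]`
and `F n λ` the first component of `A n λ ^ n * (0,1)ᵀ`, the sequence `F n` converges,
uniformly on every compact subset of `ℝ`, to `ω`, where `ω λ = 2·sin(λ/2)/λ` for `λ ≠ 0`
and `ω 0 = 1`. -/
theorem stmt_13
    (A : ℕ → ℝ → Matrix (Fin 2) (Fin 2) ℝ) (F : ℕ → ℝ → ℝ)
    (hA : ∀ n : ℕ, 1 ≤ n → ∀ l : ℝ,
      A n l = 1 + (1 / (2 * (n : ℝ))) •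
        !![-l, 2 - l / (2 * (n : ℝ)); -l ^ 2, l - l ^ 2 / (2 * (n : ℝ))])
    (hF : ∀ n : ℕ, 1 ≤ n → ∀ l : ℝ, F n l = ((A n l) ^ n *ᵥ ![0, 1]) 0)
    (ω : ℝ → ℝ) (hω0 : ω 0 = 1) (hω : ∀ l : ℝ, l ≠ 0 → ω l = 2 * Real.sin (l / 2) / l)
    (K : Set ℝ) (hK : IsCompact K) :
    TendstoUniformlyOn F ω atTop K := by
  have hω' : ω = fun l => Real.sinc (l / 2) := by
    funext l
    rcases eq_or_ne l 0 with rfl | hl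
    · simp [hω0]
    · rw [hω l hl, Real.sinc_of_ne_zero (by positivity)]
      field_simp
  rw [← tendstoLocallyUniformlyOn_iff_tendstoUniformlyOn_of_compact hK,
    tendstoLocallyUniformlyOn_iff_filter]
  intro l₀ _
  rw [tendstoUniformlyOnFilter_iff_tendsto]
  have hl : Tendsto (fun q : ℕ × ℝ => q.2) (atTop ×ˢ nhdsWithin l₀ K) (nhds l₀) :=
    tendsto_snd.mono_right nhdsWithin_le_nhds
  have hx : Tendsto (fun q : ℕ × ℝ => q.2 / (2 * (q.1 : ℝ))) (atTop ×ˢ nhdsWithin l₀ K)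
      (nhds 0) :=
    hl.div_atTop ((tendsto_natCast_atTop_atTop.comp tendsto_fst).const_mul_atTop two_pos)
  let G : ℝ × ℝ → ℝ := fun p =>
    (1 - p.1 / 2) * Real.sinc (p.2 / 2 / Real.sinc (Real.arcsin (p.1 / 2)))
      / (Real.sinc (Real.arcsin (p.1 / 2)) * Real.cos (Real.arcsin (p.1 / 2)))
  have hG : ContinuousAt G (0, l₀) := by
    have hα : Continuous fun p : ℝ × ℝ => Real.arcsin (p.1 / 2) :=
      Real.continuous_arcsin.comp (by fun_prop)
    have hs := Real.continuous_sinc.comp hα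
    refine ContinuousAt.div (ContinuousAt.mul (by fun_prop)
      (Real.continuous_sinc.continuousAt.comp (ContinuousAt.div (by fun_prop)
        hs.continuousAt (by simp)))) (hs.mul (Real.continuous_cos.comp hα)).continuousAt (by simp)
  have hFG : ∀ᶠ q : ℕ × ℝ in atTop ×ˢ nhdsWithin l₀ K,
      G (q.2 / (2 * (q.1 : ℝ)), q.2) = F q.1 q.2 := by
    filter_upwards [tendsto_fst.eventually (eventually_ge_atTop 1),
      hx.eventually (Metric.ball_mem_nhds 0 two_pos)] with q hn hq
    rw [dist_zero_right, Real.norm_eq_abs] at hq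
    rw [hF _ hn, hA _ hn, show q.2 - q.2 ^ 2 / (2 * (q.1 : ℝ))
      = q.2 - q.2 * (q.2 / (2 * (q.1 : ℝ))) by ring]
    exact (transferMatrix_pow_mulVec_apply_zero hn rfl hq).symm
  have hF' : Tendsto (fun q : ℕ × ℝ => F q.1 q.2) (atTop ×ˢ nhdsWithin l₀ K)
      (nhds (ω l₀)) := by
    have h : Tendsto _ _ _ := hG.tendsto.comp (hx.prodMk_nhds hl)
    have hG₀ : G (0, l₀) = ω l₀ := by simp [G, hω']
    rw [hG₀] at h
    exact h.congr' hFG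
  have hω_cont : Continuous ω := by
    rw [hω']
    exact Real.continuous_sinc.comp (by fun_prop)
  exact (((hω_cont.tendsto l₀).comp hl).prodMk_nhds hF').mono_right (nhds_le_uniformity _)
end

section
/- For each integer n ≥ 1 and λ ∈ ℝ, let A_n(λ) = I + (1/(2n)) · [[−λ, 2 − λ/(2n)], [−λ², λ − λ²/(2n)]] and let F_n(λ) be the first component of A_n(λ)^n · (0, 1)ᵀ. Then for every integer m ≥ 1 and every ε > 0 there exists N such that for all n ≥ N the function F_n has at least m distinct zeros in the open interval (0, 2πm + ε). (Equivalently: the m-th smallest positive eigenvalue λ_{m,n} of the boundary value problem −y″ = λ·ρ_n·y, y(0) = y(1) = 0 with weight ρ_n = ∑_{k=1}^n (δ_{(k−1/2)/n} − δ_{k/n}) satisfies λ_{m,n} < 2πm + ε for all sufficiently large n.) -/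
open Matrix Real

/-- Chebyshev formula for the powers of a matrix annihilated by `X² - 2 cos θ X + 1`. -/
theorem sin_smul_pow_eq {M : Matrix (Fin 2) (Fin 2) ℝ} {θ : ℝ}
    (hM : M * M = (2 * cos θ) • M - 1) (j : ℕ) :
    sin θ • M ^ j = sin (j * θ) • M - sin (j * θ - θ) • (1 : Matrix (Fin 2) (Fin 2) ℝ) := by
  induction j with
  | zero => simp
  | succ j ih =>
    have h1 : ((j + 1 : ℕ) : ℝ) * θ = j * θ + θ := by push_cast; ring
    have h2 : sin (j * θ + θ) = 2 * cos θ * sin (j * θ) - sin (j * θ - θ) := by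
      rw [sin_add, sin_sub]; ring
    rw [pow_succ, ← smul_mul_assoc, ih, sub_mul, smul_mul_assoc, smul_mul_assoc, hM, one_mul,
      h1, add_sub_cancel_right, h2]
    module

/-- With `x = l / (2n) = 2 sin (θ/2)`, the transfer matrix has determinant `1` and trace
`2 - x ^ 2 = 2 cos θ`. -/
theorem transfer_mul_self {h l θ : ℝ} (hl : h * l = 2 * sin (θ / 2))
    {M : Matrix (Fin 2) (Fin 2) ℝ}
    (hM : M = 1 + h • !![-l, 2 - h * l; -l ^ 2, l - h * l ^ 2]) :
    M * M = (2 * cos θ) • M - 1 := by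
  have hc : 2 * cos θ = 2 - (h * l) ^ 2 := by
    have h1 : cos θ = 2 * cos (θ / 2) ^ 2 - 1 := by rw [← cos_two_mul]; congr 1; ring
    rw [h1, hl, cos_sq']; ring
  rw [hc, hM]
  ext i j
  fin_cases i <;> fin_cases j <;>
    simp [Matrix.mul_apply, Fin.sum_univ_two] <;> ring

/-- With `A n λ = I + (1/(2n)) · [[−λ, 2 − λ/(2n)], [−λ², λ − λ²/(2n)]]`
and `F n λ` the first component of `A n λ ^ n * (0,1)ᵀ`, for every `m ≥ 1` and `ε > 0`
there is `N` such that for all `n ≥ N` the function `F n` has at least `m` distinct zeros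
in the open interval `(0, 2πm + ε)`. Equivalently, the `m`-th smallest positive
eigenvalue of `−y'' = λ·ρ_n·y`, `y(0) = y(1) = 0` with the alternating discrete weight
`ρ_n` is `< 2πm + ε` for all sufficiently large `n`. -/
theorem stmt_14
    (A : ℕ → ℝ → Matrix (Fin 2) (Fin 2) ℝ) (F : ℕ → ℝ → ℝ)
    (hA : ∀ n : ℕ, 1 ≤ n → ∀ l : ℝ,
      A n l = 1 + (1 / (2 * (n : ℝ))) •
        !![-l, 2 - l / (2 * (n : ℝ)); -l ^ 2, l - l ^ 2 / (2 * (n : ℝ))])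
    (hF : ∀ n : ℕ, 1 ≤ n → ∀ l : ℝ, F n l = ((A n l) ^ n *ᵥ ![0, 1]) 0)
    (m : ℕ) (hm : 1 ≤ m) (ε : ℝ) (hε : 0 < ε) :
    ∃ N : ℕ, 1 ≤ N ∧ ∀ n ≥ N, ∃ s : Finset ℝ, m ≤ s.card ∧
      ∀ l ∈ s, l ∈ Set.Ioo (0 : ℝ) (2 * π * m + ε) ∧ F n l = 0 := by
  refine ⟨m + 1, by omega, fun n hn => ?_⟩
  have hn1 : 1 ≤ n := by omega
  have hn0 : (0 : ℝ) < n := by exact_mod_cast hn1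
  set g : ℕ → ℝ := fun k => 4 * n * sin (((k + 1 : ℕ) : ℝ) * π / n / 2) with hg
  have hpos : ∀ k : ℕ, 0 < ((k + 1 : ℕ) : ℝ) * π / n := fun k => by positivity
  have hlt : ∀ k < m, ((k + 1 : ℕ) : ℝ) * π / n < π := fun k hk => by
    have hkn : ((k + 1 : ℕ) : ℝ) < n := by exact_mod_cast (by omega : k + 1 < n)
    rw [div_lt_iff₀ hn0, mul_comm]
    exact mul_lt_mul_of_pos_left hkn pi_pos
  refine ⟨(Finset.range m).image g, ?_, ?_⟩
  · rw [Finset.card_image_of_injOn, Finset.card_range]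
    intro a ha b hb hab
    have ha' := hlt a (by simpa using ha)
    have hb' := hlt b (by simpa using hb)
    have hsin := mul_left_cancel₀ (by positivity : (4 * n : ℝ) ≠ 0) hab
    have := injOn_sin ⟨by linarith [hpos a, pi_pos], by linarith⟩
      ⟨by linarith [hpos b, pi_pos], by linarith⟩ hsin
    field_simp at this
    exact_mod_cast add_right_cancel (by exact_mod_cast this : a + 1 = b + 1)
  · intro l hl
    obtain ⟨k, hk, rfl⟩ := Finset.mem_image.mp hl
    have hkm : k < m := Finset.mem_range.mp hk
    have hθ0 := hpos k
    have hθπ := hlt k hkm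
    set θ : ℝ := ((k + 1 : ℕ) : ℝ) * π / n with hθ
    have hnθ : n * θ = ((k + 1 : ℕ) : ℝ) * π := by rw [hθ]; field_simp
    refine ⟨⟨?_, ?_⟩, ?_⟩
    · exact mul_pos (by positivity) (sin_pos_of_pos_of_lt_pi (by linarith) (by linarith))
    · have hs : sin (θ / 2) < θ / 2 := sin_lt (by linarith)
      have hkm' : ((k + 1 : ℕ) : ℝ) ≤ m := by exact_mod_cast hkm
      calc g k < 4 * n * (θ / 2) := mul_lt_mul_of_pos_left hs (by positivity)
        _ = 2 * π * ((k + 1 : ℕ) : ℝ) := by linear_combination 2 * hnθ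
        _ ≤ 2 * π * m := by gcongr
        _ < 2 * π * m + ε := by linarith
    · have hl : 1 / (2 * (n : ℝ)) * g k = 2 * sin (θ / 2) := by
        change 1 / (2 * (n : ℝ)) * (4 * n * sin (θ / 2)) = _
        field_simp; norm_num
      have hM := transfer_mul_self (M := A n (g k)) hl (by
        rw [hA n hn1]; congr 5 <;> ring_nf)
      have hpow := sin_smul_pow_eq hM n
      rw [hnθ, sin_nat_mul_pi, zero_smul, zero_sub] at hpow
      have hentry := congrFun (congrFun hpow 0) 1
      simp only [Matrix.smul_apply, Matrix.neg_apply, smul_eq_mul, Matrix.one_apply,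
        zero_ne_one, if_false, mul_zero, neg_zero] at hentry
      have := (mul_eq_zero.mp hentry).resolve_left (sin_pos_of_pos_of_lt_pi hθ0 hθπ).ne'
      rw [hF n hn1]
      simp [Matrix.mulVec, dotProduct, Fin.sum_univ_two, this]
end
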